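/- arXiv:1008.3716 — 2 statements merged into one kernel-verified Lean document; each statement's English description precedes it below -/
import Mathlib

section
/- Let y_F be the uniform circular chain of N atoms with nearest-neighbor spacing Fε. Suppose φ is three times continuously differentiable on (0,∞), φ'(2F) ≥ 0, φ''(2F) ≤ 0, and C_φ > 0 satisfies, with F₂ = F cos(πε), max{ |φ''(2F₂) − φ''(2F)|, |φ'(2F₂)/(2F₂) − φ'(2F)/(2F)| } ≤ C_φ ε². Then for every u ∈ 𝒰, δ²E^a(y_F)[u,u] ≥ ( min{ φ''(F) + 4 φ''(2F), φ'(F)/F } − 4 π² ε² |φ''(2F)| − 4 ε² C_φ ) ‖u'‖²_{ℓ²_ε}. -/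
noncomputable section

open Real Finset

/-- Euclidean norm on `ℝ × ℝ`. -/
def enorm2 (v : ℝ × ℝ) : ℝ := Real.sqrt (v.1 ^ 2 + v.2 ^ 2)

/-- Euclidean dot product on `ℝ × ℝ`. -/
def edot (v w : ℝ × ℝ) : ℝ := v.1 * w.1 + v.2 * w.2

/-- `N`-periodic mean-zero displacements (the space `𝒰`). -/
def IsDisp (N : ℕ) (u : ℤ → ℝ × ℝ) : Prop :=
  (∀ ℓ : ℤ, u (ℓ + (N : ℤ)) = u ℓ) ∧ ∑ ℓ ∈ Finset.Icc (1 : ℤ) (N : ℤ), u ℓ = 0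

/-- Constrained displacements (the space `𝒰̃`): second component vanishes. -/
def IsDisp1D (N : ℕ) (u : ℤ → ℝ × ℝ) : Prop :=
  IsDisp N u ∧ ∀ ℓ : ℤ, (u ℓ).2 = 0

/-- Backward difference `u'_ℓ = (u_ℓ - u_{ℓ-1})/ε`. -/
def bd (ε : ℝ) (u : ℤ → ℝ × ℝ) (ℓ : ℤ) : ℝ × ℝ := ε⁻¹ • (u ℓ - u (ℓ - 1))

/-- The inner product `⟨v,w⟩ = ε ∑_{ℓ=1}^N v_ℓ · w_ℓ`. -/
def ip (N : ℕ) (ε : ℝ) (v w : ℤ → ℝ × ℝ) : ℝ :=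
  ε * ∑ ℓ ∈ Finset.Icc (1 : ℤ) (N : ℤ), edot (v ℓ) (w ℓ)

/-- The norm `‖v‖_{ℓ²_ε}`. -/
def nrm (N : ℕ) (ε : ℝ) (v : ℤ → ℝ × ℝ) : ℝ :=
  Real.sqrt (ε * ∑ ℓ ∈ Finset.Icc (1 : ℤ) (N : ℤ), (enorm2 (v ℓ)) ^ 2)

/-- The atomistic energy `E^a`. -/
def Ea (N : ℕ) (ε : ℝ) (φ : ℝ → ℝ) (y : ℤ → ℝ × ℝ) : ℝ :=
  ε * ∑ ℓ ∈ Finset.Icc (1 : ℤ) (N : ℤ),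
    (φ (enorm2 (bd ε y ℓ)) + φ (enorm2 (bd ε y (ℓ + 1) + bd ε y ℓ)))

/-- The Cauchy–Born energy `E^CB`. -/
def ECB (N : ℕ) (ε : ℝ) (φ : ℝ → ℝ) (y : ℤ → ℝ × ℝ) : ℝ :=
  ε * ∑ ℓ ∈ Finset.Icc (1 : ℤ) (N : ℤ),
    (φ (enorm2 (bd ε y ℓ)) + φ (2 * enorm2 (bd ε y ℓ)))

/-- The bond-angle energy `E^b`. -/
def Eb (N : ℕ) (ε α : ℝ) (y : ℤ → ℝ × ℝ) : ℝ :=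
  ε * ∑ ℓ ∈ Finset.Icc (1 : ℤ) (N : ℤ),
    α * (1 - edot (bd ε y (ℓ + 1)) (bd ε y ℓ) /
      (enorm2 (bd ε y (ℓ + 1)) * enorm2 (bd ε y ℓ)))

/-- The quasi-nonlocal energy `E^QNL`. -/
def EQNL (N K : ℕ) (ε : ℝ) (φ : ℝ → ℝ) (y : ℤ → ℝ × ℝ) : ℝ :=
  ε * ∑ ℓ ∈ Finset.Icc (1 : ℤ) (N : ℤ), φ (enorm2 (bd ε y ℓ))
  + ε * ∑ ℓ ∈ Finset.Icc (1 : ℤ) (K : ℤ), φ (enorm2 (bd ε y (ℓ + 1) + bd ε y ℓ))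
  + ε * ∑ ℓ ∈ Finset.Icc ((K : ℤ) + 2) (N : ℤ), φ (2 * enorm2 (bd ε y ℓ))
  + ε / 2 * φ (2 * enorm2 (bd ε y 1)) + ε / 2 * φ (2 * enorm2 (bd ε y ((K : ℤ) + 1)))

/-- First variation `δE(y)[u] = (d/dt) E(y + t u) |_{t=0}`. -/
def dE (E : (ℤ → ℝ × ℝ) → ℝ) (y u : ℤ → ℝ × ℝ) : ℝ :=
  deriv (fun t : ℝ => E (fun ℓ => y ℓ + t • u ℓ)) 0

/-- Second variation `δ²E(y)[u,v] = (∂²/∂t∂s) E(y + t u + s v) |_{t=s=0}`. -/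
def d2E (E : (ℤ → ℝ × ℝ) → ℝ) (y u v : ℤ → ℝ × ℝ) : ℝ :=
  deriv (fun s : ℝ => deriv (fun t : ℝ => E (fun ℓ => y ℓ + t • u ℓ + s • v ℓ)) 0) 0

/-- The linear chain `y_{F,ℓ} = (Fεℓ, 0)`. -/
def yLin (ε F : ℝ) : ℤ → ℝ × ℝ := fun ℓ => (F * ε * ℓ, 0)

/-- The uniform circular chain of radius `R = Fε/(2 sin(πε))`. -/
def yCirc (ε F : ℝ) : ℤ → ℝ × ℝ := fun ℓ =>
  (F * ε / (2 * Real.sin (π * ε)) * Real.cos (2 * π * ε * ℓ),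
   F * ε / (2 * Real.sin (π * ε)) * Real.sin (2 * π * ε * ℓ))


open Filter Topology in
lemma aux_second (φ : ℝ → ℝ) (hφ : ContDiffOn ℝ 3 φ (Set.Ioi 0)) (r c s : ℝ) (hr : 0 < r)
    (hcs : s ^ 2 + c ^ 2 = 1) (q : ℝ × ℝ) :
    ∃ g' : ℝ → ℝ, (∀ᶠ t in 𝓝 (0:ℝ),
      HasDerivAt (fun t : ℝ => φ (enorm2 ((-(r * s), r * c) + t • q))) (g' t) t) ∧
      HasDerivAt g' (deriv (deriv φ) r * (-s * q.1 + c * q.2) ^ 2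
        + deriv φ r / r * (c * q.1 + s * q.2) ^ 2) 0 := by
  set P : ℝ → ℝ := fun t => (-(r * s) + t * q.1) ^ 2 + (r * c + t * q.2) ^ 2 with hP
  have hfun : (fun t : ℝ => φ (enorm2 ((-(r * s), r * c) + t • q))) = fun t => φ (√(P t)) := by
    funext t; simp [enorm2, hP]
  have hP0 : P 0 = r ^ 2 := by simp only [hP]; linear_combination r ^ 2 * hcs
  have hs0 : √(P 0) = r := by rw [hP0]; exact Real.sqrt_sq hr.le
  have hPd : ∀ t, HasDerivAt P (2 * ((-(r * s) + t * q.1) * q.1 + (r * c + t * q.2) * q.2)) t := by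
    intro t
    have h1 : HasDerivAt (fun t : ℝ => -(r * s) + t * q.1) q.1 t := by
      simpa using ((hasDerivAt_id t).mul_const q.1).const_add (-(r * s))
    have h2 : HasDerivAt (fun t : ℝ => r * c + t * q.2) q.2 t := by
      simpa using ((hasDerivAt_id t).mul_const q.2).const_add (r * c)
    refine ((h1.pow 2).add (h2.pow 2)).congr_deriv ?_
    push_cast; ring
  have hev : ∀ᶠ t in 𝓝 (0:ℝ), 0 < P t := by
    apply (hPd 0).continuousAt.eventually (lt_mem_nhds _)
    rw [hP0]; positivity
  have hsd : ∀ t, 0 < P t → HasDerivAt (fun t => √(P t))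
      (((-(r * s) + t * q.1) * q.1 + (r * c + t * q.2) * q.2) / √(P t)) t := by
    intro t ht
    refine ((hPd t).sqrt ht.ne').congr_deriv ?_
    field_simp
  have hφd : ∀ x, 0 < x → HasDerivAt φ (deriv φ x) x := by
    intro x hx
    exact ((hφ.contDiffAt (Ioi_mem_nhds hx)).differentiableAt (by norm_num)).hasDerivAt
  have hφdd : HasDerivAt (deriv φ) (deriv (deriv φ) r) r := by
    have h2 : ContDiffOn ℝ 2 (deriv φ) (Set.Ioi 0) :=
      hφ.deriv_of_isOpen isOpen_Ioi (by norm_num)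
    exact ((h2.contDiffAt (Ioi_mem_nhds hr)).differentiableAt (by norm_num)).hasDerivAt
  refine ⟨fun t => deriv φ (√(P t)) *
    (((-(r * s) + t * q.1) * q.1 + (r * c + t * q.2) * q.2) / √(P t)), ?_, ?_⟩
  · filter_upwards [hev] with t ht
    rw [hfun]
    exact (hφd _ (Real.sqrt_pos.2 ht)).comp t (hsd t ht)
  · have hS := hsd 0 hev.self_of_nhds
    have hA : HasDerivAt (fun t : ℝ => deriv φ (√(P t))) _ 0 :=
      HasDerivAt.comp (h₂ := deriv φ) (h := fun t => √(P t)) 0 (by rw [hs0]; exact hφdd) hS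
    have hL : HasDerivAt (fun t : ℝ => (-(r * s) + t * q.1) * q.1 + (r * c + t * q.2) * q.2)
        (q.1 ^ 2 + q.2 ^ 2) 0 := by
      have h1 : HasDerivAt (fun t : ℝ => t * (q.1 ^ 2 + q.2 ^ 2) + (-(r * s) * q.1 + r * c * q.2))
        (q.1 ^ 2 + q.2 ^ 2) 0 := by
        simpa using ((hasDerivAt_id (0:ℝ)).mul_const (q.1 ^ 2 + q.2 ^ 2)).add_const
          (-(r * s) * q.1 + r * c * q.2)
      convert h1 using 2
      ring
    refine (hA.mul (hL.div hS (by rw [hs0]; exact hr.ne'))).congr_deriv ?_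
    simp only [Pi.div_apply, hs0]
    field_simp
    linear_combination (-r ^ 2 * (deriv φ r) * (q.1 ^ 2 + q.2 ^ 2)) * hcs

lemma aux_shift (N : ℕ) (f : ℤ → ℝ) (hf : ∀ l, f (l + N) = f l) :
    ∑ l ∈ Finset.Icc (1:ℤ) N, f (l + 1) = ∑ l ∈ Finset.Icc (1:ℤ) N, f l := by
  have h : ∀ n : ℕ, ∑ l ∈ Finset.Icc (1:ℤ) n, (f (l + 1) - f l) = f (n + 1) - f 1 := by
    intro n
    induction n with
    | zero => simp
    | succ n ih =>
      have : Finset.Icc (1:ℤ) ((n + 1 : ℕ) : ℤ) = insert ((n:ℤ) + 1) (Finset.Icc (1:ℤ) n) := by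
        ext x; simp; omega
      rw [this, Finset.sum_insert (by simp), ih]
      push_cast; ring
  have := h N
  rw [Finset.sum_sub_distrib, add_comm (N:ℤ) 1, hf 1] at this
  linarith

/-- Key quadratic estimate. -/
lemma aux_quad (N : ℕ) (a b : ℤ → ℝ) (ha : ∀ l, a (l + N) = a l) (hb : ∀ l, b (l + N) = b l)
    (c s : ℝ) :
    ∑ l ∈ Finset.Icc (1:ℤ) N, (c * (a l + a (l + 1)) + s * (b (l + 1) - b l)) ^ 2
      ≤ 4 * c ^ 2 * ∑ l ∈ Finset.Icc (1:ℤ) N, a l ^ 2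
        + 4 * s ^ 2 * ∑ l ∈ Finset.Icc (1:ℤ) N, b l ^ 2 := by
  have h1 := aux_shift N (fun l => 2 * c ^ 2 * a l ^ 2 + 2 * s ^ 2 * b l ^ 2
    + 2 * c * s * (a l * b l) * 2) (fun l => by simp only [ha, hb])
  have h2 : ∑ l ∈ Finset.Icc (1:ℤ) N, (c * (a l + a (l + 1)) + s * (b (l + 1) - b l)) ^ 2
      ≤ ∑ l ∈ Finset.Icc (1:ℤ) N, ((4 * c ^ 2 * a l ^ 2 + 4 * s ^ 2 * b l ^ 2)
        + ((2 * c ^ 2 * a (l + 1) ^ 2 + 2 * s ^ 2 * b (l + 1) ^ 2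
            + 2 * c * s * (a (l + 1) * b (l + 1)) * 2)
          - (2 * c ^ 2 * a l ^ 2 + 2 * s ^ 2 * b l ^ 2 + 2 * c * s * (a l * b l) * 2))) := by
    apply Finset.sum_le_sum
    intro l _
    nlinarith [sq_nonneg (c * (a (l + 1) - a l) + s * (b l + b (l + 1)))]
  refine h2.trans_eq ?_
  rw [Finset.sum_add_distrib, Finset.sum_sub_distrib, h1, sub_self, add_zero,
    Finset.sum_add_distrib, Finset.mul_sum, Finset.mul_sum]

lemma aux_bd (ε F : ℝ) (hε : ε ≠ 0) (hs : Real.sin (π * ε) ≠ 0) (l : ℤ) :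
    bd ε (yCirc ε F) l = (-(F * Real.sin ((2 * l - 1) * (π * ε))),
      F * Real.cos ((2 * l - 1) * (π * ε))) := by
  have e1 : 2 * π * ε * (l:ℝ) = (2 * l - 1) * (π * ε) + π * ε := by ring
  have e2 : 2 * π * ε * ((l:ℝ) - 1) = (2 * l - 1) * (π * ε) - π * ε := by ring
  unfold bd yCirc
  push_cast
  rw [e1, e2, Real.cos_add, Real.cos_sub, Real.sin_add, Real.sin_sub]
  generalize Real.sin (π * ε) = S at *
  generalize Real.cos (π * ε) = C at *
  generalize (2 * (l:ℝ) - 1) * (π * ε) = α at *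
  ext
  · simp only [Prod.fst_sub, Prod.smul_fst, Prod.mk_sub_mk, smul_eq_mul]
    field_simp
    ring
  · simp only [Prod.snd_sub, Prod.smul_snd, Prod.mk_sub_mk, smul_eq_mul]
    field_simp
    ring

lemma aux_bd2 (ε F : ℝ) (hε : ε ≠ 0) (hs : Real.sin (π * ε) ≠ 0) (l : ℤ) :
    bd ε (yCirc ε F) (l + 1) + bd ε (yCirc ε F) l
      = (-(2 * (F * Real.cos (π * ε)) * Real.sin (2 * l * (π * ε))),
      2 * (F * Real.cos (π * ε)) * Real.cos (2 * l * (π * ε))) := by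
  rw [aux_bd ε F hε hs, aux_bd ε F hε hs]
  have e1 : (2 * ((l + 1 : ℤ):ℝ) - 1) * (π * ε) = 2 * l * (π * ε) + π * ε := by push_cast; ring
  have e2 : (2 * (l:ℝ) - 1) * (π * ε) = 2 * l * (π * ε) - π * ε := by ring
  rw [e1, e2, Real.cos_add, Real.cos_sub, Real.sin_add, Real.sin_sub]
  ext
  · simp only [Prod.mk_add_mk]; ring
  · simp only [Prod.mk_add_mk]; ring

lemma bd_lin (ε : ℝ) (y u : ℤ → ℝ × ℝ) (t : ℝ) (l : ℤ) :
    bd ε (fun l => y l + t • u l) l = bd ε y l + t • bd ε u l := by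
  unfold bd
  module

open Filter Topology in
lemma aux_d2 (N : ℕ) (ε : ℝ) (hε : ε ≠ 0) (hs : Real.sin (π * ε) ≠ 0)
    (hc : 0 < Real.cos (π * ε))
    (φ : ℝ → ℝ) (hφ : ContDiffOn ℝ 3 φ (Set.Ioi 0)) (F : ℝ) (hF : 0 < F) (u : ℤ → ℝ × ℝ) :
    d2E (Ea N ε φ) (yCirc ε F) u u = ε * ∑ l ∈ Finset.Icc (1:ℤ) N,
      ((deriv (deriv φ) F * (-Real.sin ((2 * l - 1) * (π * ε)) * (bd ε u l).1
          + Real.cos ((2 * l - 1) * (π * ε)) * (bd ε u l).2) ^ 2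
        + deriv φ F / F * (Real.cos ((2 * l - 1) * (π * ε)) * (bd ε u l).1
          + Real.sin ((2 * l - 1) * (π * ε)) * (bd ε u l).2) ^ 2)
      + (deriv (deriv φ) (2 * (F * Real.cos (π * ε))) *
          (-Real.sin (2 * l * (π * ε)) * (bd ε u (l + 1) + bd ε u l).1
          + Real.cos (2 * l * (π * ε)) * (bd ε u (l + 1) + bd ε u l).2) ^ 2
        + deriv φ (2 * (F * Real.cos (π * ε))) / (2 * (F * Real.cos (π * ε))) *
          (Real.cos (2 * l * (π * ε)) * (bd ε u (l + 1) + bd ε u l).1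
          + Real.sin (2 * l * (π * ε)) * (bd ε u (l + 1) + bd ε u l).2) ^ 2)) := by
  choose g hg1 hg2 using fun l : ℤ => aux_second φ hφ F (Real.cos ((2 * l - 1) * (π * ε)))
    (Real.sin ((2 * l - 1) * (π * ε))) hF (Real.sin_sq_add_cos_sq _) (bd ε u l)
  choose k hk1 hk2 using fun l : ℤ => aux_second φ hφ (2 * (F * Real.cos (π * ε)))
    (Real.cos (2 * l * (π * ε))) (Real.sin (2 * l * (π * ε))) (by positivity)
    (Real.sin_sq_add_cos_sq _) (bd ε u (l + 1) + bd ε u l)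
  set G : ℝ → ℝ := fun t => ε * ∑ l ∈ Finset.Icc (1:ℤ) N,
    (φ (enorm2 ((-(F * Real.sin ((2 * l - 1) * (π * ε))),
      F * Real.cos ((2 * l - 1) * (π * ε))) + t • bd ε u l))
    + φ (enorm2 ((-(2 * (F * Real.cos (π * ε)) * Real.sin (2 * l * (π * ε))),
      2 * (F * Real.cos (π * ε)) * Real.cos (2 * l * (π * ε)))
        + t • (bd ε u (l + 1) + bd ε u l)))) with hG
  have hE : ∀ s t : ℝ, Ea N ε φ (fun l => yCirc ε F l + t • u l + s • u l) = G (t + s) := by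
    intro s t
    have : (fun l => yCirc ε F l + t • u l + s • u l)
        = fun l => yCirc ε F l + (t + s) • u l := by
      funext l; module
    rw [this]
    simp only [Ea, hG]
    congr 1
    apply Finset.sum_congr rfl
    intro l _
    have e : bd ε (yCirc ε F) (l + 1) + (t + s) • bd ε u (l + 1)
        + (bd ε (yCirc ε F) l + (t + s) • bd ε u l)
        = (bd ε (yCirc ε F) (l + 1) + bd ε (yCirc ε F) l)
          + (t + s) • (bd ε u (l + 1) + bd ε u l) := by module
    rw [bd_lin, bd_lin, e, aux_bd2 ε F hε hs, aux_bd ε F hε hs]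
  unfold d2E
  simp only [hE]
  have h1 : (fun s : ℝ => deriv (fun t : ℝ => G (t + s)) 0) = deriv G := by
    funext s
    rw [deriv_comp_add_const, zero_add]
  rw [h1]
  have h2 : deriv G =ᶠ[𝓝 0] fun t => ε * ∑ l ∈ Finset.Icc (1:ℤ) N, (g l t + k l t) := by
    have : ∀ᶠ t in 𝓝 (0:ℝ), ∀ l ∈ Finset.Icc (1:ℤ) N, 
      (HasDerivAt (fun t : ℝ => φ (enorm2 ((-(F * Real.sin ((2 * l - 1) * (π * ε))),
      F * Real.cos ((2 * l - 1) * (π * ε))) + t • bd ε u l))) (g l t) t ∧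
      HasDerivAt (fun t : ℝ => φ (enorm2 ((-(2 * (F * Real.cos (π * ε)) * Real.sin (2 * l * (π * ε))),
      2 * (F * Real.cos (π * ε)) * Real.cos (2 * l * (π * ε)))
        + t • (bd ε u (l + 1) + bd ε u l)))) (k l t) t) := by
      rw [Filter.eventually_all_finset]
      intro l _
      exact (hg1 l).and (hk1 l)
    filter_upwards [this] with t ht
    exact ((HasDerivAt.fun_sum fun l hl => (ht l hl).1.add (ht l hl).2).const_mul ε).deriv
  rw [h2.deriv_eq]
  exact ((HasDerivAt.fun_sum fun l _ => (hg2 l).add (hk2 l)).const_mul ε).deriv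

set_option maxHeartbeats 2000000 in
theorem stmt_5 (N : ℕ) (hN : 4 ≤ N) (ε : ℝ) (hε : ε = (N : ℝ)⁻¹)
    (φ : ℝ → ℝ) (hφ : ContDiffOn ℝ 3 φ (Set.Ioi 0)) (F : ℝ) (hF : 0 < F)
    (hφ1 : 0 ≤ deriv φ (2 * F)) (hφ2 : deriv (deriv φ) (2 * F) ≤ 0)
    (Cφ : ℝ) (hCφ0 : 0 < Cφ)
    (hCφ : max |deriv (deriv φ) (2 * (F * Real.cos (π * ε))) - deriv (deriv φ) (2 * F)|
        |deriv φ (2 * (F * Real.cos (π * ε))) / (2 * (F * Real.cos (π * ε)))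
          - deriv φ (2 * F) / (2 * F)| ≤ Cφ * ε ^ 2) :
    ∀ u : ℤ → ℝ × ℝ, IsDisp N u →
      d2E (Ea N ε φ) (yCirc ε F) u u ≥
        (min (deriv (deriv φ) F + 4 * deriv (deriv φ) (2 * F)) (deriv φ F / F)
          - 4 * π ^ 2 * ε ^ 2 * |deriv (deriv φ) (2 * F)|
          - 4 * ε ^ 2 * Cφ) * (nrm N ε (bd ε u)) ^ 2 := by
  intro u hu
  have hNpos : (0:ℝ) < N := by have : 0 < N := by omega
                               exact_mod_cast this
  have hN4 : (4:ℝ) ≤ N := by exact_mod_cast hN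
  have hεpos : 0 < ε := by rw [hε]; positivity
  have hε4 : ε ≤ 1 / 4 := by
    rw [hε, one_div]; exact inv_anti₀ (by norm_num) hN4
  have hNε : (N:ℝ) * ε = 1 := by rw [hε]; field_simp
  have hπ := Real.pi_pos
  have hθ : 0 < π * ε := by positivity
  have hθ2 : π * ε ≤ π / 4 := by nlinarith
  have hs : 0 < Real.sin (π * ε) := Real.sin_pos_of_pos_of_lt_pi hθ (by linarith)
  have hc : 0 < Real.cos (π * ε) := Real.cos_pos_of_mem_Ioo ⟨by linarith, by linarith⟩
  have hsle : Real.sin (π * ε) ^ 2 ≤ π ^ 2 * ε ^ 2 := by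
    have := Real.sin_le hθ.le
    nlinarith
  have hsc := Real.sin_sq_add_cos_sq (π * ε)
  rw [aux_d2 N ε hεpos.ne' hs.ne' hc φ hφ F hF u]
  have hC1 := (abs_le.1 ((le_max_left _ _).trans hCφ)).1
  have hC2 := (abs_le.1 ((le_max_right _ _).trans hCφ)).1
  have hpos : 0 ≤ deriv φ (2 * F) / (2 * F) := by positivity
  set A := deriv (deriv φ) F
  set B := deriv φ F / F
  set A1 := deriv (deriv φ) (2 * F)
  set A2 := deriv (deriv φ) (2 * (F * Real.cos (π * ε)))
  set B2 := deriv φ (2 * (F * Real.cos (π * ε))) / (2 * (F * Real.cos (π * ε)))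
  have hbdper : ∀ l : ℤ, bd ε u (l + N) = bd ε u l := by
    intro l
    unfold bd
    rw [hu.1, show l + (N:ℤ) - 1 = (l - 1) + N by ring, hu.1]
  set a : ℤ → ℝ := fun l => -Real.sin ((2 * l - 1) * (π * ε)) * (bd ε u l).1
          + Real.cos ((2 * l - 1) * (π * ε)) * (bd ε u l).2 with ha
  set b : ℤ → ℝ := fun l => Real.cos ((2 * l - 1) * (π * ε)) * (bd ε u l).1
          + Real.sin ((2 * l - 1) * (π * ε)) * (bd ε u l).2 with hb
  have hang : ∀ l : ℤ, (2 * ((l + N : ℤ):ℝ) - 1) * (π * ε) = (2 * l - 1) * (π * ε) + 2 * π := by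
    intro l; push_cast; linear_combination 2 * π * hNε
  have haper : ∀ l : ℤ, a (l + N) = a l := by
    intro l
    simp only [ha]
    rw [hang, Real.sin_add_two_pi, Real.cos_add_two_pi, hbdper]
  have hbper : ∀ l : ℤ, b (l + N) = b l := by
    intro l
    simp only [hb]
    rw [hang, Real.sin_add_two_pi, Real.cos_add_two_pi, hbdper]
  have hab : ∀ l : ℤ, (bd ε u l).1 ^ 2 + (bd ε u l).2 ^ 2 = a l ^ 2 + b l ^ 2 := by
    intro l
    simp only [ha, hb]
    linear_combination (-((bd ε u l).1 ^ 2 + (bd ε u l).2 ^ 2)) *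
      Real.sin_sq_add_cos_sq ((2 * (l:ℝ) - 1) * (π * ε))
  have htan : ∀ l : ℤ, -Real.sin (2 * l * (π * ε)) * (bd ε u (l + 1) + bd ε u l).1
          + Real.cos (2 * l * (π * ε)) * (bd ε u (l + 1) + bd ε u l).2
      = Real.cos (π * ε) * (a l + a (l + 1)) + Real.sin (π * ε) * (b (l + 1) - b l) := by
    intro l
    simp only [ha, hb]
    have e1 : (2 * ((l + 1 : ℤ):ℝ) - 1) * (π * ε) = 2 * l * (π * ε) + π * ε := by
      push_cast; ring
    have e2 : (2 * (l:ℝ) - 1) * (π * ε) = 2 * l * (π * ε) - π * ε := by ring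
    rw [e1, e2, Real.cos_add, Real.cos_sub, Real.sin_add, Real.sin_sub, Prod.fst_add,
      Prod.snd_add]
    linear_combination (-(-Real.sin (2 * l * (π * ε)) * ((bd ε u (l + 1)).1 + (bd ε u l).1)
          + Real.cos (2 * l * (π * ε)) * ((bd ε u (l + 1)).2 + (bd ε u l).2))) * hsc
  have hnrm : nrm N ε (bd ε u) ^ 2 = ε * (∑ l ∈ Finset.Icc (1:ℤ) N, a l ^ 2
      + ∑ l ∈ Finset.Icc (1:ℤ) N, b l ^ 2) := by
    unfold nrm
    rw [Real.sq_sqrt (by positivity), ← Finset.sum_add_distrib]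
    congr 1
    apply Finset.sum_congr rfl
    intro l _
    rw [enorm2, Real.sq_sqrt (by positivity), hab]
  have hquad := aux_quad N a b haper hbper (Real.cos (π * ε)) (Real.sin (π * ε))
  have hsh := aux_shift N (fun l => a l ^ 2 + b l ^ 2) (fun l => by simp only [haper, hbper])
  have hCε : 0 ≤ Cφ * ε ^ 2 := by positivity
  -- pointwise lower bound
  have hlow : ∑ l ∈ Finset.Icc (1:ℤ) N, ((A * a l ^ 2 + B * b l ^ 2)
      + (A1 * (Real.cos (π * ε) * (a l + a (l + 1)) + Real.sin (π * ε) * (b (l + 1) - b l)) ^ 2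
        - Cφ * ε ^ 2 * (2 * (a l ^ 2 + b l ^ 2) + 2 * (a (l + 1) ^ 2 + b (l + 1) ^ 2)))) ≤
      ∑ l ∈ Finset.Icc (1:ℤ) N, ((A * a l ^ 2 + B * b l ^ 2)
      + (A2 * (-Real.sin (2 * l * (π * ε)) * (bd ε u (l + 1) + bd ε u l).1
          + Real.cos (2 * l * (π * ε)) * (bd ε u (l + 1) + bd ε u l).2) ^ 2
        + B2 * (Real.cos (2 * l * (π * ε)) * (bd ε u (l + 1) + bd ε u l).1
          + Real.sin (2 * l * (π * ε)) * (bd ε u (l + 1) + bd ε u l).2) ^ 2)) := by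
    apply Finset.sum_le_sum
    intro l _
    rw [← htan, ← hab, ← hab]
    set T := -Real.sin (2 * l * (π * ε)) * (bd ε u (l + 1) + bd ε u l).1
          + Real.cos (2 * l * (π * ε)) * (bd ε u (l + 1) + bd ε u l).2 with hT
    set M := Real.cos (2 * l * (π * ε)) * (bd ε u (l + 1) + bd ε u l).1
          + Real.sin (2 * l * (π * ε)) * (bd ε u (l + 1) + bd ε u l).2 with hM
    have hTM : T ^ 2 + M ^ 2 ≤ 2 * ((bd ε u l).1 ^ 2 + (bd ε u l).2 ^ 2)
        + 2 * ((bd ε u (l + 1)).1 ^ 2 + (bd ε u (l + 1)).2 ^ 2) := by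
      have : T ^ 2 + M ^ 2 = ((bd ε u (l + 1)).1 + (bd ε u l).1) ^ 2
          + ((bd ε u (l + 1)).2 + (bd ε u l).2) ^ 2 := by
        rw [hT, hM, Prod.fst_add, Prod.snd_add]
        linear_combination (((bd ε u (l + 1)).1 + (bd ε u l).1) ^ 2
          + ((bd ε u (l + 1)).2 + (bd ε u l).2) ^ 2) * Real.sin_sq_add_cos_sq (2 * (l:ℝ) * (π * ε))
      rw [this]
      nlinarith [sq_nonneg ((bd ε u (l + 1)).1 - (bd ε u l).1),
        sq_nonneg ((bd ε u (l + 1)).2 - (bd ε u l).2)]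
    have k1 : (A1 - Cφ * ε ^ 2) * T ^ 2 ≤ A2 * T ^ 2 :=
      mul_le_mul_of_nonneg_right (by linarith) (sq_nonneg _)
    have k2 : (-(Cφ * ε ^ 2)) * M ^ 2 ≤ B2 * M ^ 2 :=
      mul_le_mul_of_nonneg_right (by linarith) (sq_nonneg _)
    have k3 := mul_le_mul_of_nonneg_left hTM hCε
    linarith
  rw [hnrm]
  set SA := ∑ l ∈ Finset.Icc (1:ℤ) N, a l ^ 2 with hSA
  set SB := ∑ l ∈ Finset.Icc (1:ℤ) N, b l ^ 2 with hSB
  have hSA0 : 0 ≤ SA := Finset.sum_nonneg fun _ _ => sq_nonneg _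
  have hSB0 : 0 ≤ SB := Finset.sum_nonneg fun _ _ => sq_nonneg _
  rw [ge_iff_le, ← mul_assoc, mul_comm _ ε, mul_assoc]
  refine mul_le_mul_of_nonneg_left (le_trans ?_ hlow) hεpos.le
  simp only [Finset.sum_add_distrib, Finset.sum_sub_distrib, ← Finset.mul_sum] at hsh ⊢
  rw [hsh, ← hSA, ← hSB, abs_of_nonpos hφ2]
  have hm1 := min_le_left (A + 4 * A1) B
  have hm2 := min_le_right (A + 4 * A1) B
  set m := min (A + 4 * A1) B
  set Q := ∑ l ∈ Finset.Icc (1:ℤ) N,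
    (Real.cos (π * ε) * (a l + a (l + 1)) + Real.sin (π * ε) * (b (l + 1) - b l)) ^ 2
  have hQ : Q ≤ 4 * SA + 4 * (π ^ 2 * ε ^ 2) * SB := by
    refine hquad.trans ?_
    have : Real.cos (π * ε) ^ 2 ≤ 1 := by nlinarith [sq_nonneg (Real.sin (π * ε))]
    have k1 := mul_le_mul_of_nonneg_right this hSA0
    have k2 := mul_le_mul_of_nonneg_right hsle hSB0
    linarith
  have k1 := mul_le_mul_of_nonpos_left hQ hφ2
  have k2 := mul_le_mul_of_nonneg_right hm1 hSA0
  have k3 := mul_le_mul_of_nonneg_right hm2 hSB0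
  have k4 : 0 ≤ (π ^ 2 * ε ^ 2) * (-A1) * SA := by
    have h0 : 0 ≤ -A1 := by linarith
    exact mul_nonneg (mul_nonneg (mul_nonneg (sq_nonneg _) (sq_nonneg _)) h0) hSA0
  linarith
end
end

section
/- Let y_F be the uniform circular chain of N atoms with nearest-neighbor spacing Fε, let f ∈ 𝒰, and let u^a ∈ 𝒰 satisfy δE^a(y_F)[v] + δ²E^a(y_F)[u^a, v] = ⟨f, v⟩ for all v ∈ 𝒰. Suppose φ is three times continuously differentiable on (0,∞) and C_φ > 0 satisfies, with F₂ = F cos(πε), max{ |φ''(2F₂) − φ''(2F)|, |φ'(2F₂)/(2F₂) − φ'(2F)/(2F)| } ≤ C_φ ε². Set C₁ = max{ |φ''(2F)|, |φ'(2F)/(2F)|, 4π² |φ''(2F) − φ'(2F)/(2F)| + 12 C_φ }, C₂ = 4π C_φ, and C_κ = 4 C_φ (1 + π² ε²) F + 2π² |φ'(2F)|. Then for every v ∈ 𝒰, | δE^CB(y_F)[v] + δ²E^CB(y_F)[u^a, v] − ⟨f, v⟩ | ≤ [ C_κ ε² + (C₁ ε² + C₂ ε⁴)( ‖(u^a)'''‖_{ℓ²_ε}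 + ‖(u^a)''‖_{ℓ²_ε} + ‖(u^a)'‖_{ℓ²_ε} ) ] ‖v'‖_{ℓ²_ε}. -/
noncomputable section

open Real Finset

lemma enorm2_sq (p : ℝ × ℝ) : enorm2 p ^ 2 = p.1 ^ 2 + p.2 ^ 2 := by
  unfold enorm2; exact Real.sq_sqrt (by positivity)

lemma enorm2_nonneg (p : ℝ × ℝ) : 0 ≤ enorm2 p := Real.sqrt_nonneg _

lemma edot_le (w v : ℝ × ℝ) : |edot w v| ≤ enorm2 w * enorm2 v := by
  apply abs_le_of_sq_le_sq _ (mul_nonneg (enorm2_nonneg _) (enorm2_nonneg _))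
  rw [mul_pow, enorm2_sq, enorm2_sq]; unfold edot
  nlinarith [sq_nonneg (w.1 * v.2 - w.2 * v.1)]

lemma enorm2_add (w v : ℝ × ℝ) : enorm2 (w + v) ≤ enorm2 w + enorm2 v := by
  apply le_of_sq_le_sq _ (add_nonneg (enorm2_nonneg _) (enorm2_nonneg _))
  have h := le_trans (le_abs_self _) (edot_le w v)
  unfold edot at h
  rw [add_sq, enorm2_sq, enorm2_sq, enorm2_sq]
  simp only [Prod.fst_add, Prod.snd_add]
  nlinarith

lemma enorm2_smul (c : ℝ) (w : ℝ × ℝ) : enorm2 (c • w) = |c| * enorm2 w := by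
  rw [← abs_of_nonneg (enorm2_nonneg (c • w)), ← abs_of_nonneg (enorm2_nonneg w), ← abs_mul,
    ← sq_eq_sq_iff_abs_eq_abs, mul_pow, enorm2_sq, enorm2_sq]
  simp only [Prod.smul_fst, Prod.smul_snd, smul_eq_mul]; ring

/-- derivative of the norm along a line -/
lemma hasDerivAt_enorm2 (p q : ℝ × ℝ) (hp : 0 < enorm2 p) :
    HasDerivAt (fun t : ℝ => enorm2 (p + t • q)) (edot p q / enorm2 p) 0 := by
  have hpos : p.1 ^ 2 + p.2 ^ 2 ≠ 0 := by
    rw [← enorm2_sq]; positivity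
  have h1 : HasDerivAt (fun t : ℝ => (p.1 + t * q.1) ^ 2 + (p.2 + t * q.2) ^ 2)
      (2 * edot p q) 0 := by
    have ha := (((hasDerivAt_id (0:ℝ)).mul_const q.1).const_add p.1).pow 2
    have hb := (((hasDerivAt_id (0:ℝ)).mul_const q.2).const_add p.2).pow 2
    refine (ha.add hb).congr_deriv ?_
    simp [edot]; ring
  have h2 := h1.sqrt (by simpa using hpos)
  refine h2.congr_deriv ?_
  simp only [zero_mul, add_zero]
  change _ / (2 * enorm2 p) = _
  field_simp

lemma hasDerivAt_edot (p q r : ℝ × ℝ) :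
    HasDerivAt (fun s : ℝ => edot (p + s • r) q) (edot r q) 0 := by
  have ha := (((hasDerivAt_id (0:ℝ)).mul_const r.1).const_add p.1).mul_const q.1
  have hb := (((hasDerivAt_id (0:ℝ)).mul_const r.2).const_add p.2).mul_const q.2
  refine (ha.add hb).congr_deriv ?_
  simp [edot]

lemma first_term (ψ ψ' : ℝ → ℝ) (h1 : ∀ x > 0, HasDerivAt ψ (ψ' x) x)
    (p q : ℝ × ℝ) (hp : 0 < enorm2 p) :
    HasDerivAt (fun t : ℝ => ψ (enorm2 (p + t • q))) (ψ' (enorm2 p) * (edot p q / enorm2 p)) 0 := by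
  have h := hasDerivAt_enorm2 p q hp
  exact HasDerivAt.comp (h₂ := ψ) (0:ℝ) (by simpa using h1 _ hp) h

lemma second_term (ψ' ψ'' : ℝ → ℝ) (h2 : ∀ x > 0, HasDerivAt ψ' (ψ'' x) x)
    (e q r : ℝ × ℝ) (ρ : ℝ) (hρ : 0 < ρ) (he : enorm2 e = 1) :
    HasDerivAt (fun s : ℝ => ψ' (enorm2 (ρ • e + s • r)) *
        (edot (ρ • e + s • r) q / enorm2 (ρ • e + s • r)))
      (ψ'' ρ * (edot e q * edot e r) + ψ' ρ / ρ * (edot q r - edot e q * edot e r)) 0 := by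
  have hn : enorm2 (ρ • e) = ρ := by rw [enorm2_smul, he, abs_of_pos hρ, mul_one]
  have hp : 0 < enorm2 (ρ • e) := by rw [hn]; exact hρ
  have hA := first_term ψ' ψ'' h2 (ρ • e) r hp
  have hB := (hasDerivAt_edot (ρ • e) q r).div (hasDerivAt_enorm2 (ρ • e) r hp)
    (by simpa using hp.ne')
  refine (hA.mul hB).congr_deriv ?_
  simp only [zero_smul, add_zero, hn, Pi.div_apply]
  have hd : ∀ z, edot (ρ • e) z = ρ * edot e z := by
    intro z; simp [edot]; ring
  have hc : edot r q = edot q r := by simp [edot]; ring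
  rw [hd, hd, hc]
  field_simp

lemma ev_pos (p r : ℝ × ℝ) (hp : 0 < enorm2 p) :
    ∀ᶠ s : ℝ in nhds 0, 0 < enorm2 (p + s • r) :=
  (hasDerivAt_enorm2 p r hp).continuousAt.eventually (lt_mem_nhds (by simpa using hp))

lemma first_sum (N : ℕ) (ε : ℝ) (ψ₁ ψ₁' ψ₂ ψ₂' : ℝ → ℝ)
    (h1 : ∀ x > 0, HasDerivAt ψ₁ (ψ₁' x) x) (h2 : ∀ x > 0, HasDerivAt ψ₂ (ψ₂' x) x)
    (p₁ q₁ p₂ q₂ : ℤ → ℝ × ℝ) 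
    (hp₁ : ∀ ℓ ∈ Finset.Icc (1 : ℤ) (N : ℤ), 0 < enorm2 (p₁ ℓ))
    (hp₂ : ∀ ℓ ∈ Finset.Icc (1 : ℤ) (N : ℤ), 0 < enorm2 (p₂ ℓ)) :
    deriv (fun t : ℝ => ε * ∑ ℓ ∈ Finset.Icc (1 : ℤ) (N : ℤ),
      (ψ₁ (enorm2 (p₁ ℓ + t • q₁ ℓ)) + ψ₂ (enorm2 (p₂ ℓ + t • q₂ ℓ)))) 0 =
    ε * ∑ ℓ ∈ Finset.Icc (1 : ℤ) (N : ℤ),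
      (ψ₁' (enorm2 (p₁ ℓ)) * (edot (p₁ ℓ) (q₁ ℓ) / enorm2 (p₁ ℓ)) +
       ψ₂' (enorm2 (p₂ ℓ)) * (edot (p₂ ℓ) (q₂ ℓ) / enorm2 (p₂ ℓ))) := by
  apply HasDerivAt.deriv
  apply HasDerivAt.const_mul
  apply HasDerivAt.fun_sum
  intro ℓ hℓ
  exact (first_term ψ₁ ψ₁' h1 _ _ (hp₁ ℓ hℓ)).add (first_term ψ₂ ψ₂' h2 _ _ (hp₂ ℓ hℓ))

lemma second_sum (N : ℕ) (ε : ℝ) (ψ₁ ψ₁' ψ₁'' ψ₂ ψ₂' ψ₂'' : ℝ → ℝ)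
    (h1 : ∀ x > 0, HasDerivAt ψ₁ (ψ₁' x) x) (h2 : ∀ x > 0, HasDerivAt ψ₂ (ψ₂' x) x)
    (h1' : ∀ x > 0, HasDerivAt ψ₁' (ψ₁'' x) x) (h2' : ∀ x > 0, HasDerivAt ψ₂' (ψ₂'' x) x)
    (ρ₁ ρ₂ : ℝ) (hρ₁ : 0 < ρ₁) (hρ₂ : 0 < ρ₂)
    (e₁ q₁ r₁ e₂ q₂ r₂ : ℤ → ℝ × ℝ) (he₁ : ∀ ℓ, enorm2 (e₁ ℓ) = 1) (he₂ : ∀ ℓ, enorm2 (e₂ ℓ) = 1) :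
    deriv (fun s : ℝ => deriv (fun t : ℝ => ε * ∑ ℓ ∈ Finset.Icc (1 : ℤ) (N : ℤ),
      (ψ₁ (enorm2 (ρ₁ • e₁ ℓ + s • r₁ ℓ + t • q₁ ℓ)) +
       ψ₂ (enorm2 (ρ₂ • e₂ ℓ + s • r₂ ℓ + t • q₂ ℓ)))) 0) 0 =
    ε * ∑ ℓ ∈ Finset.Icc (1 : ℤ) (N : ℤ),
      ((ψ₁'' ρ₁ * (edot (e₁ ℓ) (q₁ ℓ) * edot (e₁ ℓ) (r₁ ℓ)) + ψ₁' ρ₁ / ρ₁ *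
          (edot (q₁ ℓ) (r₁ ℓ) - edot (e₁ ℓ) (q₁ ℓ) * edot (e₁ ℓ) (r₁ ℓ))) +
       (ψ₂'' ρ₂ * (edot (e₂ ℓ) (q₂ ℓ) * edot (e₂ ℓ) (r₂ ℓ)) + ψ₂' ρ₂ / ρ₂ *
          (edot (q₂ ℓ) (r₂ ℓ) - edot (e₂ ℓ) (q₂ ℓ) * edot (e₂ ℓ) (r₂ ℓ)))) := by
  have hn : ∀ (ρ : ℝ) (e : ℝ × ℝ), 0 < ρ → enorm2 e = 1 → 0 < enorm2 (ρ • e) := by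
    intro ρ e hρ he
    rw [enorm2_smul, he, abs_of_pos hρ, mul_one]; exact hρ
  have ev1 : ∀ᶠ s : ℝ in nhds 0, ∀ ℓ ∈ Finset.Icc (1 : ℤ) (N : ℤ),
      0 < enorm2 (ρ₁ • e₁ ℓ + s • r₁ ℓ) :=
    (Filter.eventually_all_finset _).2 fun ℓ _ => ev_pos _ _ (hn _ _ hρ₁ (he₁ ℓ))
  have ev2 : ∀ᶠ s : ℝ in nhds 0, ∀ ℓ ∈ Finset.Icc (1 : ℤ) (N : ℤ),
      0 < enorm2 (ρ₂ • e₂ ℓ + s • r₂ ℓ) :=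
    (Filter.eventually_all_finset _).2 fun ℓ _ => ev_pos _ _ (hn _ _ hρ₂ (he₂ ℓ))
  rw [Filter.EventuallyEq.deriv_eq (f := fun s : ℝ => ε * ∑ ℓ ∈ Finset.Icc (1 : ℤ) (N : ℤ),
      (ψ₁' (enorm2 (ρ₁ • e₁ ℓ + s • r₁ ℓ)) *
        (edot (ρ₁ • e₁ ℓ + s • r₁ ℓ) (q₁ ℓ) / enorm2 (ρ₁ • e₁ ℓ + s • r₁ ℓ)) +
       ψ₂' (enorm2 (ρ₂ • e₂ ℓ + s • r₂ ℓ)) *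
        (edot (ρ₂ • e₂ ℓ + s • r₂ ℓ) (q₂ ℓ) / enorm2 (ρ₂ • e₂ ℓ + s • r₂ ℓ))))]
  · apply HasDerivAt.deriv
    apply HasDerivAt.const_mul
    apply HasDerivAt.fun_sum
    intro ℓ hℓ
    exact (second_term ψ₁' ψ₁'' h1' _ _ _ ρ₁ hρ₁ (he₁ ℓ)).add
      (second_term ψ₂' ψ₂'' h2' _ _ _ ρ₂ hρ₂ (he₂ ℓ))
  · filter_upwards [ev1, ev2] with s hs1 hs2
    exact first_sum N ε ψ₁ ψ₁' ψ₂ ψ₂' h1 h2 (fun ℓ => ρ₁ • e₁ ℓ + s • r₁ ℓ) q₁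
      (fun ℓ => ρ₂ • e₂ ℓ + s • r₂ ℓ) q₂ hs1 hs2

/-- Reflection form. -/
def Rf (c s : ℝ) (w v : ℝ × ℝ) : ℝ :=
  -c * (w.1 * v.1 - w.2 * v.2) - s * (w.1 * v.2 + w.2 * v.1)

lemma Rf_le (c s : ℝ) (h : c ^ 2 + s ^ 2 = 1) (w v : ℝ × ℝ) :
    |Rf c s w v| ≤ enorm2 w * enorm2 v := by
  apply abs_le_of_sq_le_sq _ (mul_nonneg (enorm2_nonneg _) (enorm2_nonneg _))
  rw [mul_pow, enorm2_sq, enorm2_sq]; unfold Rf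
  have : (w.1 ^ 2 + w.2 ^ 2) * (v.1 ^ 2 + v.2 ^ 2) =
    (c ^ 2 + s ^ 2) * ((w.1 ^ 2 + w.2 ^ 2) * (v.1 ^ 2 + v.2 ^ 2)) := by rw [h, one_mul]
  rw [this]
  have := sq_nonneg (s * (w.1 * v.1 - w.2 * v.2) - c * (w.1 * v.2 + w.2 * v.1))
  nlinarith

lemma mix_le (a d k x y m : ℝ) (hk : |k| ≤ 1) (hx : |x| ≤ m) (hy : |y| ≤ m) :
    |(a + d) / 2 * x + (d - a) / 2 * (k * y)| ≤ max |d| |a| * m := by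
  have hm : 0 ≤ m := (abs_nonneg x).trans hx
  have hky : |k * y| ≤ m := by
    rw [abs_mul]; nlinarith [abs_nonneg k, abs_nonneg y]
  have h1 : |(a + d) / 2 * x + (d - a) / 2 * (k * y)| ≤ |(a + d) / 2| * m + |(d - a) / 2| * m := by
    refine (abs_add_le _ _).trans ?_
    rw [abs_mul, abs_mul ((d - a) / 2)]
    gcongr
  refine h1.trans ?_
  rw [← add_mul]
  refine mul_le_mul_of_nonneg_right ?_ hm
  have hd := le_max_left |d| |a|
  have ha := le_max_right |d| |a|
  have := neg_abs_le d; have := le_abs_self d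
  have := neg_abs_le a; have := le_abs_self a
  rcases abs_cases ((a + d) / 2) with h | h <;> rcases abs_cases ((d - a) / 2) with h' | h' <;>
    linarith

lemma first_sum' (N : ℕ) (ε : ℝ) (ψ₁ ψ₁' ψ₂ ψ₂' : ℝ → ℝ)
    (h1 : ∀ x > 0, HasDerivAt ψ₁ (ψ₁' x) x) (h2 : ∀ x > 0, HasDerivAt ψ₂ (ψ₂' x) x)
    (ρ₁ ρ₂ : ℝ) (hρ₁ : 0 < ρ₁) (hρ₂ : 0 < ρ₂)
    (e₁ q₁ e₂ q₂ : ℤ → ℝ × ℝ) (he₁ : ∀ ℓ, enorm2 (e₁ ℓ) = 1) (he₂ : ∀ ℓ, enorm2 (e₂ ℓ) = 1) :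
    deriv (fun t : ℝ => ε * ∑ ℓ ∈ Finset.Icc (1 : ℤ) (N : ℤ),
      (ψ₁ (enorm2 (ρ₁ • e₁ ℓ + t • q₁ ℓ)) + ψ₂ (enorm2 (ρ₂ • e₂ ℓ + t • q₂ ℓ)))) 0 =
    ε * ∑ ℓ ∈ Finset.Icc (1 : ℤ) (N : ℤ),
      (ψ₁' ρ₁ * edot (e₁ ℓ) (q₁ ℓ) + ψ₂' ρ₂ * edot (e₂ ℓ) (q₂ ℓ)) := by
  have hn : ∀ (ρ : ℝ) (e : ℝ × ℝ), 0 < ρ → enorm2 e = 1 → enorm2 (ρ • e) = ρ := by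
    intro ρ e hρ he
    rw [enorm2_smul, he, abs_of_pos hρ, mul_one]
  have hd : ∀ (ρ : ℝ) (e q : ℝ × ℝ), 0 < ρ → edot (ρ • e) q / ρ = edot e q := by
    intro ρ e q hρ
    simp only [edot, Prod.smul_fst, Prod.smul_snd, smul_eq_mul]; field_simp
  rw [first_sum N ε ψ₁ ψ₁' ψ₂ ψ₂' h1 h2 (fun ℓ => ρ₁ • e₁ ℓ) q₁ (fun ℓ => ρ₂ • e₂ ℓ) q₂
    (fun ℓ _ => by rw [hn _ _ hρ₁ (he₁ ℓ)]; exact hρ₁)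
    (fun ℓ _ => by rw [hn _ _ hρ₂ (he₂ ℓ)]; exact hρ₂)]
  congr 1
  refine Finset.sum_congr rfl fun ℓ _ => ?_
  simp only [hn _ _ hρ₁ (he₁ ℓ), hn _ _ hρ₂ (he₂ ℓ), hd _ _ _ hρ₁, hd _ _ _ hρ₂]

/-- unit tangent -/
def ed (a : ℝ) : ℝ × ℝ := (-Real.sin a, Real.cos a)

lemma ed_norm (a : ℝ) : enorm2 (ed a) = 1 := by
  simp [enorm2, ed]

/-- Hessian form. -/
def Kf (A B : ℝ) (e w v : ℝ × ℝ) : ℝ :=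
  B * (edot e w * edot e v) + A * (edot w v - edot e w * edot e v)

lemma Kf_eq (A B a : ℝ) (w v : ℝ × ℝ) : Kf A B (ed a) w v =
    (A + B) / 2 * edot w v + (B - A) / 2 * Rf (cos (2 * a)) (sin (2 * a)) w v := by
  rw [Real.cos_two_mul, Real.sin_two_mul]
  have h := Real.sin_sq_add_cos_sq a
  simp only [Kf, edot, Rf, ed]
  have h1 : Real.sin a ^ 2 = 1 - Real.cos a ^ 2 := by linarith
  ring_nf
  rw [h1]
  ring

lemma Rf_rot (a b : ℝ) (w v : ℝ × ℝ) : Rf (cos (2 * (a + b))) (sin (2 * (a + b))) w v =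
    cos (2 * b) * Rf (cos (2 * a)) (sin (2 * a)) w v
    + sin (2 * b) * Rf (-sin (2 * a)) (cos (2 * a)) w v := by
  rw [mul_add, Real.cos_add, Real.sin_add]; unfold Rf; ring

lemma Rf_rot' (a b : ℝ) (w v : ℝ × ℝ) : Rf (cos (2 * (a - b))) (sin (2 * (a - b))) w v =
    cos (2 * b) * Rf (cos (2 * a)) (sin (2 * a)) w v
    - sin (2 * b) * Rf (-sin (2 * a)) (cos (2 * a)) w v := by
  rw [mul_sub, Real.cos_sub, Real.sin_sub]; unfold Rf; ring

lemma pointwise (A B A2 B2 a b δ : ℝ) (hb : 0 ≤ b) (hB : |B2 - B| ≤ δ) (hA : |A2 - A| ≤ δ)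
    (wm w wp v : ℝ × ℝ) :
    |4 * Kf A B (ed a) w v - Kf A2 B2 (ed (a + b)) (wp + w) v - Kf A2 B2 (ed (a - b)) (w + wm) v|
    ≤ (max |B| |A| * enorm2 (wp - (2:ℝ) • w + wm) + 4 * b ^ 2 * |B - A| * enorm2 w
      + |B - A| * b * enorm2 (wp - wm) + δ * (enorm2 (wp + w) + enorm2 (w + wm))) * enorm2 v := by
  have h2a : ∀ a : ℝ, cos (2 * a) ^ 2 + sin (2 * a) ^ 2 = 1 := fun a => by
    rw [add_comm]; exact Real.sin_sq_add_cos_sq _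
  have h2a' : (-sin (2 * a)) ^ 2 + cos (2 * a) ^ 2 = 1 := by
    rw [neg_sq]; exact Real.sin_sq_add_cos_sq _
  have key : 4 * Kf A B (ed a) w v - Kf A2 B2 (ed (a + b)) (wp + w) v
      - Kf A2 B2 (ed (a - b)) (w + wm) v =
    -((A + B) / 2 * edot (wp - (2:ℝ) • w + wm) v
      + (B - A) / 2 * (cos (2 * b) * Rf (cos (2 * a)) (sin (2 * a)) (wp - (2:ℝ) • w + wm) v))
    + 2 * (B - A) * (1 - cos (2 * b)) * Rf (cos (2 * a)) (sin (2 * a)) w v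
    - (B - A) / 2 * sin (2 * b) * Rf (-sin (2 * a)) (cos (2 * a)) (wp - wm) v
    - (((A2 - A) + (B2 - B)) / 2 * edot (wp + w) v + ((B2 - B) - (A2 - A)) / 2 *
        (1 * Rf (cos (2 * (a + b))) (sin (2 * (a + b))) (wp + w) v))
    - (((A2 - A) + (B2 - B)) / 2 * edot (w + wm) v + ((B2 - B) - (A2 - A)) / 2 *
        (1 * Rf (cos (2 * (a - b))) (sin (2 * (a - b))) (w + wm) v)) := by
    rw [Kf_eq, Kf_eq, Kf_eq, Rf_rot, Rf_rot']
    simp only [Rf, edot, Prod.fst_add, Prod.snd_add, Prod.fst_sub, Prod.snd_sub, Prod.smul_fst,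
      Prod.smul_snd, smul_eq_mul]
    ring
  have e1 := mix_le A B (cos (2 * b)) _ _ _ (Real.abs_cos_le_one _)
    (edot_le (wp - (2:ℝ) • w + wm) v) (Rf_le _ _ (h2a a) (wp - (2:ℝ) • w + wm) v)
  have e4 := mix_le (A2 - A) (B2 - B) 1 _ _ _ (by simp)
    (edot_le (wp + w) v) (Rf_le _ _ (h2a (a + b)) (wp + w) v)
  have e5 := mix_le (A2 - A) (B2 - B) 1 _ _ _ (by simp)
    (edot_le (w + wm) v) (Rf_le _ _ (h2a (a - b)) (w + wm) v)
  have hmax : max |B2 - B| |A2 - A| ≤ δ := max_le hB hA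
  have n1 : 0 ≤ enorm2 (wp + w) * enorm2 v := mul_nonneg (enorm2_nonneg _) (enorm2_nonneg _)
  have n2 : 0 ≤ enorm2 (w + wm) * enorm2 v := mul_nonneg (enorm2_nonneg _) (enorm2_nonneg _)
  have e4' := e4.trans (mul_le_mul_of_nonneg_right hmax n1)
  have e5' := e5.trans (mul_le_mul_of_nonneg_right hmax n2)
  have hc : 1 - cos (2 * b) ≤ 2 * b ^ 2 := by
    have := Real.one_sub_sq_div_two_le_cos (x := 2 * b); nlinarith
  have hc0 : 0 ≤ 1 - cos (2 * b) := by linarith [Real.cos_le_one (2 * b)]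
  have hs : |sin (2 * b)| ≤ 2 * b := by
    refine (Real.abs_sin_le_abs).trans ?_
    rw [abs_of_nonneg (by positivity)]
  have e2 : |2 * (B - A) * (1 - cos (2 * b)) * Rf (cos (2 * a)) (sin (2 * a)) w v| ≤
      (2 * |B - A| * (2 * b ^ 2)) * (enorm2 w * enorm2 v) := by
    rw [abs_mul, abs_mul, abs_mul, abs_of_nonneg hc0, abs_two]
    have := Rf_le _ _ (h2a a) w v
    gcongr
  have e3 : |(B - A) / 2 * sin (2 * b) * Rf (-sin (2 * a)) (cos (2 * a)) (wp - wm) v| ≤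
      (|B - A| / 2 * (2 * b)) * (enorm2 (wp - wm) * enorm2 v) := by
    rw [abs_mul, abs_mul, abs_div, abs_two]
    have := Rf_le _ _ h2a' (wp - wm) v
    gcongr
  rw [key]
  have t : ∀ x1 x2 x3 x4 x5 : ℝ, |-x1 + x2 - x3 - x4 - x5| ≤ |x1| + |x2| + |x3| + |x4| + |x5| := by
    intro x1 x2 x3 x4 x5
    rw [abs_le]
    constructor <;> linarith [neg_abs_le x1, le_abs_self x1, neg_abs_le x2, le_abs_self x2,
      neg_abs_le x3, le_abs_self x3, neg_abs_le x4, le_abs_self x4, neg_abs_le x5, le_abs_self x5]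
  refine (t _ _ _ _ _).trans ?_
  refine (add_le_add (add_le_add (add_le_add (add_le_add e1 e2) e3) e4') e5').trans ?_
  apply le_of_eq; ring

lemma sum_shift_aux (g : ℤ → ℝ) (n : ℕ) :
    ∑ ℓ ∈ Finset.Icc (1 : ℤ) (n : ℤ), g (ℓ + 1) =
      ∑ ℓ ∈ Finset.Icc (1 : ℤ) (n : ℤ), g ℓ + g (n + 1) - g 1 := by
  induction n with
  | zero => simp
  | succ k ih =>
    have h : Finset.Icc (1 : ℤ) ((k + 1 : ℕ) : ℤ) = insert ((k : ℤ) + 1) (Finset.Icc (1 : ℤ) k) := by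
      ext x; simp only [Finset.mem_Icc, Finset.mem_insert]; push_cast; omega
    rw [h, Finset.sum_insert (by simp), Finset.sum_insert (by simp), ih]
    push_cast; ring

lemma sum_shift (N : ℕ) (g : ℤ → ℝ) (hg : ∀ ℓ, g (ℓ + N) = g ℓ) :
    ∑ ℓ ∈ Finset.Icc (1 : ℤ) (N : ℤ), g (ℓ + 1) = ∑ ℓ ∈ Finset.Icc (1 : ℤ) (N : ℤ), g ℓ := by
  rw [sum_shift_aux, add_comm (N : ℤ) 1, hg 1]; ring

lemma nrm_shift (N : ℕ) (ε : ℝ) (x : ℤ → ℝ × ℝ) (hx : ∀ ℓ, x (ℓ + N) = x ℓ) :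
    nrm N ε (fun ℓ => x (ℓ + 1)) = nrm N ε x := by
  unfold nrm
  rw [sum_shift N (fun ℓ => enorm2 (x ℓ) ^ 2) (fun ℓ => by simp only [hx])]

lemma nrm_shift' (N : ℕ) (ε : ℝ) (x : ℤ → ℝ × ℝ) (hx : ∀ ℓ, x (ℓ + N) = x ℓ) :
    nrm N ε (fun ℓ => x (ℓ - 1)) = nrm N ε x := by
  have := nrm_shift N ε (fun ℓ => x (ℓ - 1)) (fun ℓ => by
    rw [show ℓ + (N : ℤ) - 1 = ℓ - 1 + N by ring, hx])
  rw [← this]; simp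

lemma bd_per (N : ℕ) (ε : ℝ) (x : ℤ → ℝ × ℝ) (hx : ∀ ℓ, x (ℓ + N) = x ℓ) (ℓ : ℤ) :
    bd ε x (ℓ + N) = bd ε x ℓ := by
  unfold bd
  rw [hx, show ℓ + (N : ℤ) - 1 = ℓ - 1 + N by ring, hx]

lemma cs (N : ℕ) (ε : ℝ) (hε : 0 ≤ ε) (x v : ℤ → ℝ × ℝ) :
    ε * ∑ ℓ ∈ Finset.Icc (1 : ℤ) (N : ℤ), enorm2 (x ℓ) * enorm2 (v ℓ) ≤ nrm N ε x * nrm N ε v := by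
  unfold nrm
  rw [Real.sqrt_mul hε, Real.sqrt_mul hε]
  have h := Real.sum_mul_le_sqrt_mul_sqrt (Finset.Icc (1 : ℤ) (N : ℤ))
    (fun ℓ => enorm2 (x ℓ)) (fun ℓ => enorm2 (v ℓ))
  have h2 := mul_le_mul_of_nonneg_left h hε
  refine h2.trans (le_of_eq ?_)
  have := Real.mul_self_sqrt hε
  nth_rewrite 1 [← this]; ring

lemma bd_yCirc (ε F : ℝ) (hε : ε ≠ 0) (hs : Real.sin (π * ε) ≠ 0) (ℓ : ℤ) :
    bd ε (yCirc ε F) ℓ = F • ed (2 * π * ε * ℓ - π * ε) := by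
  have e1 : 2 * π * ε * ℓ = (2 * π * ε * ℓ - π * ε) + π * ε := by ring
  have e2 : 2 * π * ε * ((ℓ - 1 : ℤ) : ℝ) = (2 * π * ε * ℓ - π * ε) - π * ε := by push_cast; ring
  unfold bd yCirc
  simp only [e2]
  generalize hα : 2 * π * ε * (ℓ:ℝ) - π * ε = α at *
  rw [e1]
  clear e1 e2 hα
  generalize π * ε = b at *
  ext
  · simp only [Prod.smul_fst, Prod.fst_sub, ed, smul_eq_mul, Real.cos_add, Real.cos_sub]
    field_simp; ring
  · simp only [Prod.smul_snd, Prod.snd_sub, ed, smul_eq_mul, Real.sin_add, Real.sin_sub]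
    field_simp; ring

lemma ed_add (F a b : ℝ) : F • ed (a + b) + F • ed (a - b) = (2 * (F * Real.cos b)) • ed a := by
  ext
  · simp only [Prod.smul_fst, Prod.fst_add, ed, smul_eq_mul, Real.sin_add, Real.sin_sub]; ring
  · simp only [Prod.smul_snd, Prod.snd_add, ed, smul_eq_mul, Real.cos_add, Real.cos_sub]; ring

set_option maxHeartbeats 4000000 in
theorem stmt_10 (N : ℕ) (hN : 4 ≤ N) (ε : ℝ) (hε : ε = (N : ℝ)⁻¹)
    (φ : ℝ → ℝ) (hφ : ContDiffOn ℝ 3 φ (Set.Ioi 0)) (F : ℝ) (hF : 0 < F)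
    (Cφ : ℝ) (hCφ0 : 0 < Cφ)
    (hCφ : max |deriv (deriv φ) (2 * (F * Real.cos (π * ε))) - deriv (deriv φ) (2 * F)|
        |deriv φ (2 * (F * Real.cos (π * ε))) / (2 * (F * Real.cos (π * ε)))
          - deriv φ (2 * F) / (2 * F)| ≤ Cφ * ε ^ 2)
    (C1 C2 Cκ : ℝ)
    (hC1 : C1 = max (max |deriv (deriv φ) (2 * F)| |deriv φ (2 * F) / (2 * F)|)
      (4 * π ^ 2 * |deriv (deriv φ) (2 * F) - deriv φ (2 * F) / (2 * F)| + 12 * Cφ))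
    (hC2 : C2 = 4 * π * Cφ)
    (hCκ : Cκ = 4 * Cφ * (1 + π ^ 2 * ε ^ 2) * F + 2 * π ^ 2 * |deriv φ (2 * F)|)
    (f ua : ℤ → ℝ × ℝ) (hf : IsDisp N f) (hua : IsDisp N ua)
    (heq : ∀ v : ℤ → ℝ × ℝ, IsDisp N v →
      dE (Ea N ε φ) (yCirc ε F) v + d2E (Ea N ε φ) (yCirc ε F) ua v = ip N ε f v) :
    ∀ v : ℤ → ℝ × ℝ, IsDisp N v →
      |dE (ECB N ε φ) (yCirc ε F) v + d2E (ECB N ε φ) (yCirc ε F) ua v - ip N ε f v| ≤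
        (Cκ * ε ^ 2 + (C1 * ε ^ 2 + C2 * ε ^ 4) *
          (nrm N ε (bd ε (bd ε (bd ε ua))) + nrm N ε (bd ε (bd ε ua)) + nrm N ε (bd ε ua)))
          * nrm N ε (bd ε v) := by
  intro v hv
  have hNpos : (0:ℝ) < N := by
    have : 0 < N := by omega
    exact_mod_cast this
  have hN4 : (4:ℝ) ≤ N := by exact_mod_cast hN
  have hε0 : 0 < ε := by rw [hε]; positivity
  have hNε : (N:ℝ) * ε = 1 := by rw [hε]; field_simp
  have hε4 : ε ≤ 1 / 4 := by nlinarith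
  set b := π * ε with hb
  have hb0 : 0 < b := by positivity
  have hb4 : b ≤ π / 4 := by rw [hb]; nlinarith [Real.pi_pos]
  have hsin : 0 < Real.sin b := Real.sin_pos_of_pos_of_lt_pi hb0 (by linarith [Real.pi_pos])
  have hcos : 0 < Real.cos b :=
    Real.cos_pos_of_mem_Ioo ⟨by linarith [Real.pi_pos], by linarith [Real.pi_pos]⟩
  have hF2 : 0 < 2 * (F * Real.cos b) := by positivity
  -- derivatives of φ
  have d1 : ∀ x > 0, HasDerivAt φ (deriv φ x) x := fun x hx =>
    ((hφ.contDiffAt (Ioi_mem_nhds hx)).differentiableAt (by norm_num)).hasDerivAt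
  have hφ' : ContDiffOn ℝ 2 (deriv φ) (Set.Ioi 0) :=
    hφ.deriv_of_isOpen isOpen_Ioi (by norm_num)
  have d2 : ∀ x > 0, HasDerivAt (deriv φ) (deriv (deriv φ) x) x := fun x hx =>
    ((hφ'.contDiffAt (Ioi_mem_nhds hx)).differentiableAt (by norm_num)).hasDerivAt
  have c1 : ∀ x > 0, HasDerivAt (fun x => φ (2 * x)) ((fun x => 2 * deriv φ (2 * x)) x) x := by
    intro x hx
    have h := HasDerivAt.comp (h₂ := φ) x (d1 (2 * x) (by linarith))
      ((hasDerivAt_id x).const_mul 2)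
    refine h.congr_deriv ?_
    simp; ring
  have c2 : ∀ x > 0, HasDerivAt (fun x => 2 * deriv φ (2 * x))
      ((fun x => 4 * deriv (deriv φ) (2 * x)) x) x := by
    intro x hx
    have h := (HasDerivAt.comp (h₂ := deriv φ) x (d2 (2 * x) (by linarith))
      ((hasDerivAt_id x).const_mul 2)).const_mul 2
    refine h.congr_deriv ?_
    simp; ring
  -- geometry
  let tt : ℤ → ℝ × ℝ := fun ℓ => ed (2 * π * ε * ℓ - b)
  let ss : ℤ → ℝ × ℝ := fun ℓ => ed (2 * π * ε * ℓ)
  have htt : ∀ ℓ, enorm2 (tt ℓ) = 1 := fun ℓ => ed_norm _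
  have hss : ∀ ℓ, enorm2 (ss ℓ) = 1 := fun ℓ => ed_norm _
  have hy : ∀ ℓ, bd ε (yCirc ε F) ℓ = F • tt ℓ := fun ℓ =>
    bd_yCirc ε F hε0.ne' hsin.ne' ℓ
  have hy2 : ∀ ℓ, F • tt (ℓ + 1) + F • tt ℓ = (2 * (F * Real.cos b)) • ss ℓ := by
    intro ℓ
    rw [← ed_add]
    have : 2 * π * ε * ((ℓ + 1 : ℤ) : ℝ) - b = 2 * π * ε * ℓ + b := by
      push_cast; rw [hb]; ring
    simp only [tt, this]
  have l1 : ∀ (y u : ℤ → ℝ × ℝ) (t : ℝ) (ℓ : ℤ),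
      bd ε (fun ℓ => y ℓ + t • u ℓ) ℓ = bd ε y ℓ + t • bd ε u ℓ := by
    intro y u t ℓ; ext <;> simp [bd] <;> ring
  have l1b : ∀ (u : ℤ → ℝ × ℝ) (t : ℝ) (ℓ : ℤ),
      bd ε (fun ℓ => yCirc ε F ℓ + t • u ℓ) (ℓ + 1) + bd ε (fun ℓ => yCirc ε F ℓ + t • u ℓ) ℓ
        = (2 * (F * Real.cos b)) • ss ℓ + t • (bd ε u (ℓ + 1) + bd ε u ℓ) := by
    intro u t ℓ
    rw [l1, l1, hy, hy, ← hy2]; module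
  have l2 : ∀ (u v : ℤ → ℝ × ℝ) (t s : ℝ) (ℓ : ℤ),
      bd ε (fun ℓ => yCirc ε F ℓ + t • u ℓ + s • v ℓ) ℓ
        = F • tt ℓ + s • bd ε v ℓ + t • bd ε u ℓ := by
    intro u v t s ℓ
    rw [l1 (fun ℓ => yCirc ε F ℓ + t • u ℓ), l1, hy]; module
  have l2b : ∀ (u v : ℤ → ℝ × ℝ) (t s : ℝ) (ℓ : ℤ),
      bd ε (fun ℓ => yCirc ε F ℓ + t • u ℓ + s • v ℓ) (ℓ + 1) +
        bd ε (fun ℓ => yCirc ε F ℓ + t • u ℓ + s • v ℓ) ℓ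
        = (2 * (F * Real.cos b)) • ss ℓ + s • (bd ε v (ℓ + 1) + bd ε v ℓ)
          + t • (bd ε u (ℓ + 1) + bd ε u ℓ) := by
    intro u v t s ℓ
    rw [l2, l2, ← hy2]; module
  -- variations
  have va1 : dE (Ea N ε φ) (yCirc ε F) v = ε * ∑ ℓ ∈ Finset.Icc (1 : ℤ) (N : ℤ),
      (deriv φ F * edot (tt ℓ) (bd ε v ℓ) +
        deriv φ (2 * (F * Real.cos b)) * edot (ss ℓ) (bd ε v (ℓ + 1) + bd ε v ℓ)) := by
    unfold dE Ea
    simp only [l1b]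
    simp only [l1, hy]
    exact first_sum' N ε φ (deriv φ) φ (deriv φ) d1 d1 F _ hF hF2 tt (bd ε v) ss
      (fun ℓ => bd ε v (ℓ + 1) + bd ε v ℓ) htt hss
  have vc1 : dE (ECB N ε φ) (yCirc ε F) v = ε * ∑ ℓ ∈ Finset.Icc (1 : ℤ) (N : ℤ),
      (deriv φ F * edot (tt ℓ) (bd ε v ℓ) +
        2 * deriv φ (2 * F) * edot (tt ℓ) (bd ε v ℓ)) := by
    unfold dE ECB
    simp only [l1, hy]
    exact first_sum' N ε φ (deriv φ) (fun x => φ (2 * x)) (fun x => 2 * deriv φ (2 * x)) d1 c1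
      F F hF hF tt (bd ε v) tt (bd ε v) htt htt
  have va2 : d2E (Ea N ε φ) (yCirc ε F) ua v = ε * ∑ ℓ ∈ Finset.Icc (1 : ℤ) (N : ℤ),
      (Kf (deriv φ F / F) (deriv (deriv φ) F) (tt ℓ) (bd ε ua ℓ) (bd ε v ℓ) +
        Kf (deriv φ (2 * (F * Real.cos b)) / (2 * (F * Real.cos b)))
          (deriv (deriv φ) (2 * (F * Real.cos b))) (ss ℓ) (bd ε ua (ℓ + 1) + bd ε ua ℓ)
          (bd ε v (ℓ + 1) + bd ε v ℓ)) := by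
    unfold d2E Ea
    simp only [l2b]
    simp only [l2]
    exact second_sum N ε φ (deriv φ) (deriv (deriv φ)) φ (deriv φ) (deriv (deriv φ))
      d1 d1 d2 d2 F _ hF hF2 tt (bd ε ua) (bd ε v) ss
      (fun ℓ => bd ε ua (ℓ + 1) + bd ε ua ℓ)
      (fun ℓ => bd ε v (ℓ + 1) + bd ε v ℓ) htt hss
  have vc2 : d2E (ECB N ε φ) (yCirc ε F) ua v = ε * ∑ ℓ ∈ Finset.Icc (1 : ℤ) (N : ℤ),
      (Kf (deriv φ F / F) (deriv (deriv φ) F) (tt ℓ) (bd ε ua ℓ) (bd ε v ℓ) +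
        Kf (2 * deriv φ (2 * F) / F) (4 * deriv (deriv φ) (2 * F)) (tt ℓ) (bd ε ua ℓ)
          (bd ε v ℓ)) := by
    unfold d2E ECB
    simp only [l2]
    exact second_sum N ε φ (deriv φ) (deriv (deriv φ)) (fun x => φ (2 * x))
      (fun x => 2 * deriv φ (2 * x)) (fun x => 4 * deriv (deriv φ) (2 * x))
      d1 c1 d2 c2 F F hF hF tt (bd ε ua) (bd ε v) tt (bd ε ua) (bd ε v) htt htt
  -- abbreviations
  rw [← heq v hv, va1, vc1, va2, vc2]
  have hA2c := (le_max_right _ _).trans hCφ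
  have hB2c := (le_max_left _ _).trans hCφ
  have hDF : deriv φ (2 * F) = 2 * F * (deriv φ (2 * F) / (2 * F)) := by field_simp
  have hDF2 : deriv φ (2 * (F * Real.cos b)) = 2 * (F * Real.cos b) *
      (deriv φ (2 * (F * Real.cos b)) / (2 * (F * Real.cos b))) := by field_simp
  have hDF' : 2 * deriv φ (2 * F) / F = 4 * (deriv φ (2 * F) / (2 * F)) := by field_simp; ring
  rw [hDF']
  have hCκ' : Cκ * ε ^ 2 ≥ 4 * F * (Cφ * ε ^ 2) + 4 * F * b ^ 2 * |deriv φ (2 * F) / (2 * F)| := by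
    have : |deriv φ (2 * F)| = 2 * F * |deriv φ (2 * F) / (2 * F)| := by
      rw [abs_div, abs_of_pos (by positivity : 0 < 2 * F)]; field_simp
    rw [hCκ, this, hb]
    have : 0 ≤ 4 * Cφ * (π ^ 2 * ε ^ 2) * F * ε ^ 2 := by positivity
    nlinarith
  set A := deriv φ (2 * F) / (2 * F) with hA
  set B := deriv (deriv φ) (2 * F) with hB
  set A2 := deriv φ (2 * (F * Real.cos b)) / (2 * (F * Real.cos b)) with hA2
  set B2 := deriv (deriv φ) (2 * (F * Real.cos b)) with hB2
  rw [hDF, hDF2]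
  generalize deriv φ F / F = A0
  generalize deriv (deriv φ) F = B0
  set V := bd ε v with hV
  set w := bd ε ua with hw
  have hVp : ∀ ℓ, V (ℓ + N) = V ℓ := bd_per N ε v hv.1
  have hwp : ∀ ℓ, w (ℓ + N) = w ℓ := bd_per N ε ua hua.1
  have hw2p : ∀ ℓ, bd ε w (ℓ + N) = bd ε w ℓ := bd_per N ε w hwp
  have hw3p : ∀ ℓ, bd ε (bd ε w) (ℓ + N) = bd ε (bd ε w) ℓ := bd_per N ε _ hw2p
  have hsp : ∀ ℓ, ss (ℓ + N) = ss ℓ := by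
    intro ℓ
    have : 2 * π * ε * ((ℓ + N : ℤ) : ℝ) = 2 * π * ε * ℓ + 2 * π := by
      push_cast; linear_combination 2 * π * hNε
    simp only [ss, this, ed, Real.sin_add_two_pi, Real.cos_add_two_pi]
  have sh1 := sum_shift N (fun ℓ => 2 * (F * Real.cos b) * A2 * edot (ss (ℓ - 1)) (V ℓ))
    (fun ℓ => by
      simp only [hVp, show ℓ + (N : ℤ) - 1 = ℓ - 1 + N by ring, hsp])
  have sh2 := sum_shift N (fun ℓ => Kf A2 B2 (ss (ℓ - 1)) (w ℓ + w (ℓ - 1)) (V ℓ))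
    (fun ℓ => by
      simp only [hVp, show ℓ + (N : ℤ) - 1 = ℓ - 1 + N by ring, hsp, hwp])
  simp only [add_sub_cancel_right] at sh1 sh2
  have hs1 : ∀ ℓ, ss ℓ = ed ((2 * π * ε * ℓ - b) + b) := fun ℓ => by simp only [ss, sub_add_cancel]
  have hs2 : ∀ ℓ, ss (ℓ - 1) = ed ((2 * π * ε * ℓ - b) - b) := fun ℓ => by
    simp only [ss]; congr 1; push_cast; rw [hb]; ring
  let Z : ℤ → ℝ := fun ℓ => 4 * F * (A - Real.cos b ^ 2 * A2) * edot (tt ℓ) (V ℓ) +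
    (4 * Kf A B (tt ℓ) (w ℓ) (V ℓ) - Kf A2 B2 (ss ℓ) (w (ℓ + 1) + w ℓ) (V ℓ)
      - Kf A2 B2 (ss (ℓ - 1)) (w ℓ + w (ℓ - 1)) (V ℓ))
  have hmain : ε * ∑ ℓ ∈ Finset.Icc (1 : ℤ) (N : ℤ),
        (deriv φ F * edot (tt ℓ) (V ℓ) + 2 * (2 * F * A) * edot (tt ℓ) (V ℓ)) +
      ε * ∑ ℓ ∈ Finset.Icc (1 : ℤ) (N : ℤ),
        (Kf A0 B0 (tt ℓ) (w ℓ) (V ℓ) + Kf (4 * A) (4 * B) (tt ℓ) (w ℓ) (V ℓ)) -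
      (ε * ∑ ℓ ∈ Finset.Icc (1 : ℤ) (N : ℤ), (deriv φ F * edot (tt ℓ) (V ℓ) +
          2 * (F * Real.cos b) * A2 * edot (ss ℓ) (V (ℓ + 1) + V ℓ)) +
       ε * ∑ ℓ ∈ Finset.Icc (1 : ℤ) (N : ℤ), (Kf A0 B0 (tt ℓ) (w ℓ) (V ℓ) +
          Kf A2 B2 (ss ℓ) (w (ℓ + 1) + w ℓ) (V (ℓ + 1) + V ℓ))) =
      ε * ∑ ℓ ∈ Finset.Icc (1 : ℤ) (N : ℤ), Z ℓ := by
    have ha : ∀ e x y : ℝ × ℝ, edot e (x + y) = edot e x + edot e y := by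
      intro e x y; simp [edot]; ring
    have hk : ∀ e x y z : ℝ × ℝ, Kf A2 B2 e z (x + y) = Kf A2 B2 e z x + Kf A2 B2 e z y := by
      intro e x y z; simp [edot, Kf]; ring
    have hZ : ∀ ℓ, Z ℓ = (deriv φ F * edot (tt ℓ) (V ℓ) + 2 * (2 * F * A) * edot (tt ℓ) (V ℓ)) +
        (Kf A0 B0 (tt ℓ) (w ℓ) (V ℓ) + Kf (4 * A) (4 * B) (tt ℓ) (w ℓ) (V ℓ))
        - deriv φ F * edot (tt ℓ) (V ℓ) - 2 * (F * Real.cos b) * A2 * edot (ss ℓ) (V ℓ)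
        - 2 * (F * Real.cos b) * A2 * edot (ss (ℓ - 1)) (V ℓ)
        - Kf A0 B0 (tt ℓ) (w ℓ) (V ℓ) - Kf A2 B2 (ss ℓ) (w (ℓ + 1) + w ℓ) (V ℓ)
        - Kf A2 B2 (ss (ℓ - 1)) (w ℓ + w (ℓ - 1)) (V ℓ) := by
      intro ℓ
      have h1 : edot (ss ℓ) (V ℓ) + edot (ss (ℓ - 1)) (V ℓ)
          = 2 * Real.cos b * edot (tt ℓ) (V ℓ) := by
        rw [hs1, hs2]
        simp only [tt, ed, edot, Real.sin_add, Real.sin_sub, Real.cos_add, Real.cos_sub]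
        ring
      have h4 : Kf (4 * A) (4 * B) (tt ℓ) (w ℓ) (V ℓ) = 4 * Kf A B (tt ℓ) (w ℓ) (V ℓ) := by
        unfold Kf; ring
      simp only [Z]
      rw [h4]
      linear_combination 2 * (F * Real.cos b) * A2 * h1
    simp only [hZ, ha, hk, mul_add, Finset.sum_add_distrib, Finset.sum_sub_distrib]
    simp only [sh1, sh2]
    ring
  rw [hmain]
  -- pointwise bound
  have hbdw : ∀ ℓ, w (ℓ + 1) - w (ℓ - 1) = ε • (bd ε w (ℓ + 1) + bd ε w ℓ) := by
    intro ℓ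
    have h : bd ε w (ℓ + 1) = ε⁻¹ • (w (ℓ + 1) - w ℓ) := by simp [bd]
    rw [h, bd, ← smul_add, smul_smul, mul_inv_cancel₀ hε0.ne', one_smul]; abel
  have hbdw2 : ∀ ℓ, w (ℓ + 1) - (2:ℝ) • w ℓ + w (ℓ - 1) = ε ^ 2 • bd ε (bd ε w) (ℓ + 1) := by
    intro ℓ
    have h : bd ε (bd ε w) (ℓ + 1) = ε⁻¹ • (ε⁻¹ • (w (ℓ + 1) - w ℓ) - ε⁻¹ • (w ℓ - w (ℓ - 1))) := by
      simp [bd]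
    rw [h, ← smul_sub, smul_smul, smul_smul,
      show ε ^ 2 * ε⁻¹ * ε⁻¹ = 1 by field_simp, one_smul]
    module
  let M := max |B| |A|
  let D := |B - A|
  have hM0 : 0 ≤ M := (abs_nonneg B).trans (le_max_left _ _)
  have hD0 : 0 ≤ D := abs_nonneg _
  have hfirst : |4 * F * (A - Real.cos b ^ 2 * A2)| ≤ Cκ * ε ^ 2 := by
    refine le_trans ?_ hCκ'
    have hsb : 1 - Real.cos b ^ 2 ≤ b ^ 2 := by
      have := Real.sin_sq_add_cos_sq b
      have h3 : Real.sin b ≤ b := Real.sin_le hb0.le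
      have h4 := pow_le_pow_left₀ hsin.le h3 2
      linarith
    have hc1 : Real.cos b ^ 2 ≤ 1 := Real.cos_sq_le_one b
    have : |A - Real.cos b ^ 2 * A2| ≤ Cφ * ε ^ 2 + b ^ 2 * |A| := by
      have e : A - Real.cos b ^ 2 * A2 = (1 - Real.cos b ^ 2) * A - Real.cos b ^ 2 * (A2 - A) := by
        ring
      rw [e]
      refine (abs_sub _ _).trans ?_
      rw [abs_mul, abs_mul, abs_of_nonneg (by linarith : 0 ≤ 1 - Real.cos b ^ 2),
        abs_of_nonneg (sq_nonneg (Real.cos b))]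
      have k1 : (1 - Real.cos b ^ 2) * |A| ≤ b ^ 2 * |A| := by gcongr
      have k2 : Real.cos b ^ 2 * |A2 - A| ≤ 1 * (Cφ * ε ^ 2) := by gcongr
      linarith
    rw [abs_mul, abs_of_pos (by positivity : 0 < 4 * F)]
    refine (mul_le_mul_of_nonneg_left this (by positivity)).trans (le_of_eq ?_)
    ring
  have hpt : ∀ ℓ, |Z ℓ| ≤ Cκ * ε ^ 2 * (enorm2 (tt ℓ) * enorm2 (V ℓ))
      + M * ε ^ 2 * (enorm2 (bd ε (bd ε w) (ℓ + 1)) * enorm2 (V ℓ))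
      + (4 * b ^ 2 * D + 2 * (Cφ * ε ^ 2)) * (enorm2 (w ℓ) * enorm2 (V ℓ))
      + D * b * ε * (enorm2 (bd ε w (ℓ + 1)) * enorm2 (V ℓ))
      + D * b * ε * (enorm2 (bd ε w ℓ) * enorm2 (V ℓ))
      + Cφ * ε ^ 2 * (enorm2 (w (ℓ + 1)) * enorm2 (V ℓ))
      + Cφ * ε ^ 2 * (enorm2 (w (ℓ - 1)) * enorm2 (V ℓ)) := by
    intro ℓ
    have p := pointwise A B A2 B2 (2 * π * ε * ℓ - b) b (Cφ * ε ^ 2) hb0.le hB2c hA2c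
      (w (ℓ - 1)) (w ℓ) (w (ℓ + 1)) (V ℓ)
    rw [← hs1, ← hs2, hbdw, hbdw2, enorm2_smul, enorm2_smul, abs_of_pos hε0,
      abs_of_pos (by positivity : 0 < ε ^ 2)] at p
    have q1 := enorm2_add (bd ε w (ℓ + 1)) (bd ε w ℓ)
    have q2 := enorm2_add (w (ℓ + 1)) (w ℓ)
    have q3 := enorm2_add (w ℓ) (w (ℓ - 1))
    have hV0 := enorm2_nonneg (V ℓ)
    have f1 : |4 * F * (A - Real.cos b ^ 2 * A2) * edot (tt ℓ) (V ℓ)| ≤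
        Cκ * ε ^ 2 * (enorm2 (tt ℓ) * enorm2 (V ℓ)) := by
      rw [abs_mul]
      exact mul_le_mul hfirst (edot_le _ _) (abs_nonneg _) ((abs_nonneg _).trans hfirst)
    have p' : (max |B| |A| * (ε ^ 2 * enorm2 (bd ε (bd ε w) (ℓ + 1)))
        + 4 * b ^ 2 * |B - A| * enorm2 (w ℓ)
        + |B - A| * b * (ε * enorm2 (bd ε w (ℓ + 1) + bd ε w ℓ))
        + Cφ * ε ^ 2 * (enorm2 (w (ℓ + 1) + w ℓ) + enorm2 (w ℓ + w (ℓ - 1)))) * enorm2 (V ℓ) ≤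
        (M * (ε ^ 2 * enorm2 (bd ε (bd ε w) (ℓ + 1)))
        + 4 * b ^ 2 * D * enorm2 (w ℓ)
        + D * b * (ε * (enorm2 (bd ε w (ℓ + 1)) + enorm2 (bd ε w ℓ)))
        + Cφ * ε ^ 2 * ((enorm2 (w (ℓ + 1)) + enorm2 (w ℓ)) + (enorm2 (w ℓ) + enorm2 (w (ℓ - 1)))))
          * enorm2 (V ℓ) := by
      gcongr
    refine (abs_add_le _ _).trans ((add_le_add f1 (p.trans p')).trans (le_of_eq ?_))
    ring
  have hsum : |ε * ∑ ℓ ∈ Finset.Icc (1 : ℤ) (N : ℤ), Z ℓ| ≤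
      Cκ * ε ^ 2 * (ε * ∑ ℓ ∈ Finset.Icc (1 : ℤ) (N : ℤ), enorm2 (tt ℓ) * enorm2 (V ℓ))
      + M * ε ^ 2 * (ε * ∑ ℓ ∈ Finset.Icc (1 : ℤ) (N : ℤ),
          enorm2 (bd ε (bd ε w) (ℓ + 1)) * enorm2 (V ℓ))
      + (4 * b ^ 2 * D + 2 * (Cφ * ε ^ 2)) * (ε * ∑ ℓ ∈ Finset.Icc (1 : ℤ) (N : ℤ),
          enorm2 (w ℓ) * enorm2 (V ℓ))
      + D * b * ε * (ε * ∑ ℓ ∈ Finset.Icc (1 : ℤ) (N : ℤ), enorm2 (bd ε w (ℓ + 1)) * enorm2 (V ℓ))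
      + D * b * ε * (ε * ∑ ℓ ∈ Finset.Icc (1 : ℤ) (N : ℤ), enorm2 (bd ε w ℓ) * enorm2 (V ℓ))
      + Cφ * ε ^ 2 * (ε * ∑ ℓ ∈ Finset.Icc (1 : ℤ) (N : ℤ), enorm2 (w (ℓ + 1)) * enorm2 (V ℓ))
      + Cφ * ε ^ 2 * (ε * ∑ ℓ ∈ Finset.Icc (1 : ℤ) (N : ℤ),
          enorm2 (w (ℓ - 1)) * enorm2 (V ℓ)) := by
    rw [abs_mul, abs_of_pos hε0]
    refine (mul_le_mul_of_nonneg_left ((Finset.abs_sum_le_sum_abs _ _).trans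
      (Finset.sum_le_sum fun ℓ _ => hpt ℓ)) hε0.le).trans (le_of_eq ?_)
    simp only [Finset.sum_add_distrib, ← Finset.mul_sum]
    ring
  have htn : nrm N ε tt = 1 := by
    unfold nrm
    simp only [htt]
    simp [mul_comm ε, hNε]
  have s1 := cs N ε hε0.le tt V
  have s2 := cs N ε hε0.le (fun ℓ => bd ε (bd ε w) (ℓ + 1)) V
  have s3 := cs N ε hε0.le w V
  have s4 := cs N ε hε0.le (fun ℓ => bd ε w (ℓ + 1)) V
  have s5 := cs N ε hε0.le (bd ε w) V
  have s6 := cs N ε hε0.le (fun ℓ => w (ℓ + 1)) V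
  have s7 := cs N ε hε0.le (fun ℓ => w (ℓ - 1)) V
  rw [htn] at s1
  rw [nrm_shift N ε _ hw3p] at s2
  rw [nrm_shift N ε _ hw2p] at s4
  rw [nrm_shift N ε _ hwp] at s6
  rw [nrm_shift' N ε _ hwp] at s7
  have hκ0 : 0 ≤ Cκ * ε ^ 2 := (abs_nonneg _).trans hfirst
  have hsum2 : |ε * ∑ ℓ ∈ Finset.Icc (1 : ℤ) (N : ℤ), Z ℓ| ≤
      Cκ * ε ^ 2 * (1 * nrm N ε V)
      + M * ε ^ 2 * (nrm N ε (bd ε (bd ε w)) * nrm N ε V)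
      + (4 * b ^ 2 * D + 2 * (Cφ * ε ^ 2)) * (nrm N ε w * nrm N ε V)
      + D * b * ε * (nrm N ε (bd ε w) * nrm N ε V)
      + D * b * ε * (nrm N ε (bd ε w) * nrm N ε V)
      + Cφ * ε ^ 2 * (nrm N ε w * nrm N ε V)
      + Cφ * ε ^ 2 * (nrm N ε w * nrm N ε V) := by
    refine hsum.trans ?_
    gcongr
  refine hsum2.trans ?_
  have nV : 0 ≤ nrm N ε V := Real.sqrt_nonneg _
  have nw1 : 0 ≤ nrm N ε w := Real.sqrt_nonneg _
  have nw2 : 0 ≤ nrm N ε (bd ε w) := Real.sqrt_nonneg _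
  have nw3 : 0 ≤ nrm N ε (bd ε (bd ε w)) := Real.sqrt_nonneg _
  generalize nrm N ε V = nv at *
  generalize nrm N ε w = n1 at *
  generalize nrm N ε (bd ε w) = n2 at *
  generalize nrm N ε (bd ε (bd ε w)) = n3 at *
  have m1 : M ≤ C1 := by rw [hC1]; exact le_max_left _ _
  have m2 : 4 * π ^ 2 * D + 12 * Cφ ≤ C1 := by rw [hC1]; exact le_max_right _ _
  have m3 : 0 ≤ C2 * ε ^ 4 := by rw [hC2]; positivity
  have hπ : π ≤ π ^ 2 := by nlinarith [Real.pi_gt_three]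
  have hDπ : D * π ≤ D * π ^ 2 := by gcongr
  have hDπ0 : 0 ≤ D * π ^ 2 := by positivity
  have r1 : M * ε ^ 2 ≤ C1 * ε ^ 2 + C2 * ε ^ 4 := by
    have : M * ε ^ 2 ≤ C1 * ε ^ 2 := by gcongr
    linarith
  have r2 : 2 * (D * b * ε) ≤ C1 * ε ^ 2 + C2 * ε ^ 4 := by
    have : 2 * (D * b * ε) = (2 * (D * π)) * ε ^ 2 := by rw [hb]; ring
    have h2 : (2 * (D * π)) * ε ^ 2 ≤ C1 * ε ^ 2 := by gcongr; linarith
    linarith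
  have r3 : 4 * b ^ 2 * D + 4 * (Cφ * ε ^ 2) ≤ C1 * ε ^ 2 + C2 * ε ^ 4 := by
    have : 4 * b ^ 2 * D + 4 * (Cφ * ε ^ 2) = (4 * π ^ 2 * D + 4 * Cφ) * ε ^ 2 := by rw [hb]; ring
    have h2 : (4 * π ^ 2 * D + 4 * Cφ) * ε ^ 2 ≤ C1 * ε ^ 2 := by gcongr; linarith
    linarith
  have t1 := mul_le_mul_of_nonneg_right r1 (mul_nonneg nw3 nV)
  have t2 := mul_le_mul_of_nonneg_right r2 (mul_nonneg nw2 nV)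
  have t3 := mul_le_mul_of_nonneg_right r3 (mul_nonneg nw1 nV)
  linarith
end
end
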